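/- arXiv:1210.1311 — 2 statements merged into one kernel-verified Lean document; each statement's English description precedes it below -/
import Mathlib

section
/- Let σ : A* → A* be a primitive substitution that is left proper (respectively right proper) and let τ be its left (respectively right) conjugate. Then the subshifts (X_σ, T), (X_τ, T), (X_{σ∘τ}, T) and (X_{τ∘σ}, T) are pairwise topologically conjugate, i.e., for any two of them there is a homeomorphism φ between them satisfying φ ∘ T = T ∘ φ. -/
/-- The extension of a morphism `σ` (given by its values on letters) to words,
acting by concatenation. -/
def wordApply {A B : Type*} (σ : A → List B) (w : List A) : List B :=
  (w.map σ).flatten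

/-- Composition of endomorphisms of the free monoid: `(σ ∘ τ)(x) = σ(τ(x))`. -/
def compMor {A : Type*} (σ τ : A → List A) : A → List A :=
  fun x => wordApply σ (τ x)

/-- The factor `x_i x_{i+1} ⋯ x_{i+m-1}` of a biinfinite sequence `x`. -/
def seg {A : Type*} (x : ℤ → A) (i : ℤ) (m : ℕ) : List A :=
  (List.range m).map fun k => x (i + k)

/-- The shift by `p` on biinfinite sequences; `shiftBy 1` is the shift map `T`. -/
def shiftBy {A : Type*} (p : ℤ) (x : ℤ → A) : ℤ → A :=
  fun i => x (i + p)

/-- `σ` is primitive: there is `n ≥ 1` such that every letter `b` occurs in `σⁿ(a)`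
for every letter `a`. -/
def Primitive {A : Type*} (σ : A → List A) : Prop :=
  ∃ n : ℕ, 1 ≤ n ∧ ∀ a b : A, b ∈ (wordApply σ)^[n] [a]

/-- The subshift `X_σ` generated by the endomorphism `σ`: the set of biinfinite
sequences all of whose finite factors occur in some `σⁿ(c)`. -/
def Xgen {A : Type*} (σ : A → List A) : Set (ℤ → A) :=
  { x | ∀ (i : ℤ) (m : ℕ), ∃ (n : ℕ) (c : A), seg x i m <:+: (wordApply σ)^[n] [c] }

/-- Two subshifts of `A^ℤ` are topologically conjugate: there is a homeomorphism
`φ` between them commuting with the shift `T`. -/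
def ShiftConjugate {A : Type*} [TopologicalSpace A] (X Y : Set (ℤ → A)) : Prop :=
  ∃ φ : X ≃ₜ Y, ∀ (x : ℤ → A) (hx : x ∈ X) (hx' : shiftBy 1 x ∈ X),
    (φ ⟨shiftBy 1 x, hx'⟩ : ℤ → A) = shiftBy 1 (φ ⟨x, hx⟩ : ℤ → A)

section Words

variable {A : Type*}

theorem wordApply_append {B : Type*} (f : A → List B) (v w : List A) :
    wordApply f (v ++ w) = wordApply f v ++ wordApply f w := by
  simp [wordApply]

theorem wordApply_cons {B : Type*} (f : A → List B) (a : A) (w : List A) :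
    wordApply f (a :: w) = f a ++ wordApply f w := by
  simp [wordApply]

theorem wordApply_compMor (f g : A → List A) (w : List A) :
    wordApply (compMor f g) w = wordApply f (wordApply g w) := by
  induction w with
  | nil => rfl
  | cons a w ih => rw [wordApply_cons, ih, wordApply_cons, wordApply_append]; rfl

theorem iterate_wordApply_append (f : A → List A) (n : ℕ) (v w : List A) :
    (wordApply f)^[n] (v ++ w) = (wordApply f)^[n] v ++ (wordApply f)^[n] w := by
  induction n with
  | zero => rfl
  | succ n ih => simp only [Function.iterate_succ_apply', ih, wordApply_append]

theorem iterate_wordApply_compMor_self (f : A → List A) (n : ℕ) :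
    (wordApply (compMor f f))^[n] = (wordApply f)^[2 * n] := by
  rw [Function.iterate_mul]
  congr 1
  funext w
  exact wordApply_compMor f f w

theorem length_le_length_iterate {f : A → List A} (hf : ∀ a, f a ≠ []) (n : ℕ) (w : List A) :
    w.length ≤ ((wordApply f)^[n] w).length := by
  have key : ∀ w : List A, w.length ≤ (wordApply f w).length := by
    intro w
    induction w with
    | nil => simp
    | cons a w ih =>
      have := List.length_pos_iff.2 (hf a)
      rw [wordApply_cons, List.length_append, List.length_cons]
      omega
  induction n with
  | zero => exact le_rfl
  | succ n ih =>
    rw [Function.iterate_succ_apply']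
    exact ih.trans (key _)

/-- For a non-erasing primitive endomorphism, every letter occurs in all large enough
iterates of every letter. -/
theorem Primitive.exists_forall_ge_mem {f : A → List A} (hp : Primitive f)
    (hf : ∀ a, f a ≠ []) :
    ∃ n : ℕ, 1 ≤ n ∧ ∀ m, n ≤ m → ∀ a b, b ∈ (wordApply f)^[m] [a] := by
  obtain ⟨n, hn, h⟩ := hp
  refine ⟨n, hn, fun m hm a b => ?_⟩
  obtain ⟨k, rfl⟩ := Nat.exists_eq_add_of_le hm
  rw [Function.iterate_add_apply]
  have hlen := length_le_length_iterate hf k [a]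
  match hw : (wordApply f)^[k] [a] with
  | [] => simp [hw] at hlen
  | d :: w =>
    rw [← List.singleton_append, iterate_wordApply_append]
    exact List.mem_append_left _ (h d b)

theorem Primitive.exists_le_length_iterate [Nontrivial A] {f : A → List A} (hp : Primitive f)
    (hf : ∀ a, f a ≠ []) (a : A) (K : ℕ) :
    ∃ m, K ≤ ((wordApply f)^[m] [a]).length := by
  obtain ⟨n, -, h⟩ := hp
  have two : ∀ c, 2 ≤ ((wordApply f)^[n] [c]).length := by
    intro c
    obtain ⟨x, y, hxy⟩ := exists_pair_ne A
    have hx := h c x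
    have hy := h c y
    match hw : (wordApply f)^[n] [c] with
    | [] => simp [hw] at hx
    | [d] =>
      rw [hw, List.mem_singleton] at hx hy
      exact absurd (hx.trans hy.symm) hxy
    | _ :: _ :: _ => simp
  have double : ∀ w : List A, 2 * w.length ≤ ((wordApply f)^[n] w).length := by
    intro w
    induction w with
    | nil => simp
    | cons c w ih =>
      have := two c
      rw [← List.singleton_append, iterate_wordApply_append, List.length_append,
        List.length_append, List.length_singleton]
      omega
  induction K with
  | zero => exact ⟨0, Nat.zero_le _⟩
  | succ K ih =>
    obtain ⟨m, hm⟩ := ih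
    refine ⟨n + m, ?_⟩
    have h1 := length_le_length_iterate hf m [a]
    have h2 := double ((wordApply f)^[m] [a])
    rw [List.length_singleton] at h1
    rw [Function.iterate_add_apply]
    omega

theorem Primitive.exists_long_extension [Nontrivial A] {f : A → List A} (hp : Primitive f)
    (hf : ∀ a, f a ≠ []) (c : A) (K : ℕ) :
    ∃ (m : ℕ) (a : A) (u v : List A), K ≤ u.length ∧ K ≤ v.length ∧
      (wordApply f)^[m] [a] = u ++ ([c] ++ v) := by
  obtain ⟨k, hk⟩ := hp.exists_le_length_iterate hf c (2 * K + 1)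
  obtain ⟨n, -, h⟩ := hp
  set w := (wordApply f)^[k] [c] with hw
  have hlt : K < w.length := by omega
  obtain ⟨s, t, hst⟩ := List.append_of_mem (h w[K] c)
  refine ⟨n + k, c, (wordApply f)^[n] (w.take K) ++ s,
    t ++ (wordApply f)^[n] (w.drop (K + 1)), ?_, ?_, ?_⟩
  · have := length_le_length_iterate hf n (w.take K)
    rw [List.length_take] at this
    rw [List.length_append]
    omega
  · have := length_le_length_iterate hf n (w.drop (K + 1))
    rw [List.length_drop] at this
    rw [List.length_append]
    omega
  · have hsplit : w = w.take K ++ ([w[K]] ++ w.drop (K + 1)) := by simp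
    rw [Function.iterate_add_apply, ← hw]
    conv_lhs => rw [hsplit]
    rw [iterate_wordApply_append, iterate_wordApply_append, hst]
    simp

theorem wordApply_append_comm {f g : A → List A} {p : List A}
    (h : ∀ a, f a ++ p = p ++ g a) (w : List A) :
    wordApply f w ++ p = p ++ wordApply g w := by
  induction w with
  | nil => simp [wordApply]
  | cons a w ih =>
    rw [wordApply_cons, wordApply_cons, List.append_assoc, ih, ← List.append_assoc, h,
      List.append_assoc]

theorem exists_iterate_append_comm {f g : A → List A} {p : List A}
    (h : ∀ a, f a ++ p = p ++ g a) (n : ℕ) :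
    ∃ q, ∀ w, (wordApply f)^[n] w ++ q = q ++ (wordApply g)^[n] w := by
  induction n with
  | zero => exact ⟨[], fun w => by simp⟩
  | succ n ih =>
    obtain ⟨q, hq⟩ := ih
    refine ⟨wordApply f q ++ p, fun w => ?_⟩
    simp only [Function.iterate_succ_apply']
    rw [← List.append_assoc, ← wordApply_append, hq, wordApply_append, List.append_assoc,
      wordApply_append_comm h, List.append_assoc]

theorem List.perm_of_append_eq_append {v w p : List A} (h : v ++ p = p ++ w) : v.Perm w := by
  have h' : (v ++ p).Perm (w ++ p) := h ▸ List.perm_append_comm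
  exact (List.perm_append_right_iff p).1 h'

theorem ne_nil_of_append_comm {f g : A → List A} {p : List A}
    (h : ∀ a, f a ++ p = p ++ g a) (hf : ∀ a, f a ≠ []) (a : A) : g a ≠ [] := by
  intro hg
  have := List.perm_of_append_eq_append (h a)
  rw [hg, List.perm_nil] at this
  exact hf a this

theorem primitive_iff_of_append_comm {f g : A → List A} {p : List A}
    (h : ∀ a, f a ++ p = p ++ g a) : Primitive f ↔ Primitive g := by
  refine exists_congr fun n => and_congr_right fun _ => forall₂_congr fun a b => ?_
  obtain ⟨q, hq⟩ := exists_iterate_append_comm h n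
  exact (List.perm_of_append_eq_append (hq [a])).mem_iff

/-- Conjugate primitive endomorphisms generate the same subshift. -/
theorem Xgen_eq_of_append_comm {f g : A → List A} {p : List A}
    (h : ∀ a, f a ++ p = p ++ g a) (hf : ∀ a, f a ≠ []) (hp : Primitive f) :
    Xgen f = Xgen g := by
  rcases subsingleton_or_nontrivial A with hA | hA
  · congr 1
    funext a
    have hl := (List.perm_of_append_eq_append (h a)).length_eq
    exact List.ext_getElem hl fun _ _ _ => Subsingleton.elim _ _
  have hg := ne_nil_of_append_comm h hf
  have hpg := (primitive_iff_of_append_comm h).1 hp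
  apply Set.Subset.antisymm
  · intro x hx i m
    obtain ⟨N, c, hv⟩ := hx i m
    obtain ⟨q, hq⟩ := exists_iterate_append_comm h N
    obtain ⟨k, a, u, v, hu, -, huv⟩ := hpg.exists_long_extension hg c q.length
    obtain ⟨t, ht⟩ : q <:+ (wordApply g)^[N] u :=
      List.suffix_of_suffix_length_le ⟨_, hq u⟩ ⟨_, rfl⟩
        (hu.trans (length_le_length_iterate hg N u))
    refine ⟨N + k, a, hv.trans ⟨t, q ++ (wordApply g)^[N] v, ?_⟩⟩
    rw [Function.iterate_add_apply, huv, iterate_wordApply_append, iterate_wordApply_append, ← ht]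
    have := hq [c]
    simp only [List.append_assoc, List.append_cancel_left_eq]
    rw [← List.append_assoc, this, List.append_assoc]
  · intro x hx i m
    obtain ⟨N, c, hv⟩ := hx i m
    obtain ⟨q, hq⟩ := exists_iterate_append_comm h N
    obtain ⟨k, a, u, v, -, hl, huv⟩ := hp.exists_long_extension hf c q.length
    obtain ⟨t, ht⟩ : q <+: (wordApply f)^[N] v :=
      List.prefix_of_prefix_length_le ⟨_, (hq v).symm⟩ ⟨_, rfl⟩
        (hl.trans (length_le_length_iterate hf N v))
    refine ⟨N + k, a, hv.trans ⟨(wordApply f)^[N] u ++ q, t, ?_⟩⟩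
    rw [Function.iterate_add_apply, huv, iterate_wordApply_append, iterate_wordApply_append, ← ht]
    have := hq [c]
    simp only [List.append_assoc, List.append_cancel_left_eq]
    rw [← List.append_assoc, ← this, List.append_assoc]

theorem compMor_ne_nil {f g : A → List A} (hf : ∀ a, f a ≠ []) (hg : ∀ a, g a ≠ []) (a : A) :
    compMor f g a ≠ [] := by
  have h1 := length_le_length_iterate hf 1 (g a)
  have h2 := List.length_pos_iff.2 (hg a)
  exact List.length_pos_iff.1 (h2.trans_le h1)

theorem Primitive.compMor_self {f : A → List A} (hp : Primitive f) (hf : ∀ a, f a ≠ []) :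
    Primitive (compMor f f) := by
  obtain ⟨n, hn, h⟩ := hp.exists_forall_ge_mem hf
  refine ⟨n, hn, fun a b => ?_⟩
  rw [iterate_wordApply_compMor_self]
  exact h _ (by omega) a b

theorem Xgen_compMor_self {f : A → List A} (hp : Primitive f) (hf : ∀ a, f a ≠ []) :
    Xgen (compMor f f) = Xgen f := by
  obtain ⟨n, -, h⟩ := hp.exists_forall_ge_mem hf
  apply Set.Subset.antisymm
  · intro x hx i m
    obtain ⟨N, c, hv⟩ := hx i m
    rw [iterate_wordApply_compMor_self] at hv
    exact ⟨_, c, hv⟩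
  · intro x hx i m
    obtain ⟨N, c, hv⟩ := hx i m
    obtain ⟨s, t, hst⟩ := List.append_of_mem (h (N + 2 * n) (by omega) c c)
    refine ⟨N + n, c, hv.trans ⟨(wordApply f)^[N] s, (wordApply f)^[N] t, ?_⟩⟩
    rw [iterate_wordApply_compMor_self, show 2 * (N + n) = N + (N + 2 * n) by ring,
      Function.iterate_add_apply, hst, ← List.singleton_append (l := t), iterate_wordApply_append,
      iterate_wordApply_append, List.append_assoc]

/-- The subshifts of two conjugate primitive endomorphisms and of their two compositions all
coincide. -/
theorem Xgen_eq_Xgen_compMor {f g : A → List A} {p : List A}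
    (h : ∀ a, f a ++ p = p ++ g a) (hf : ∀ a, f a ≠ []) (hp : Primitive f) :
    Xgen f = Xgen g ∧ Xgen f = Xgen (compMor f g) ∧ Xgen f = Xgen (compMor g f) := by
  have hne := compMor_ne_nil hf hf
  have hprim := hp.compMor_self hf
  refine ⟨Xgen_eq_of_append_comm h hf hp, ?_, ?_⟩ <;> rw [← Xgen_compMor_self hp hf]
  · refine Xgen_eq_of_append_comm (p := wordApply f p) (fun a => ?_) hne hprim
    simp only [compMor]
    rw [← wordApply_append, h, wordApply_append]
  · exact Xgen_eq_of_append_comm (fun a => wordApply_append_comm h (f a)) hne hprim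

theorem ShiftConjugate.of_eq [TopologicalSpace A] {X Y : Set (ℤ → A)} (h : X = Y) :
    ShiftConjugate X Y := by
  subst h
  exact ⟨Homeomorph.refl X, fun _ _ _ => rfl⟩

end Words

/-- Let `σ` be a primitive substitution which is left proper (resp. right proper) and
let `τ` be its left (resp. right) conjugate.  Then the subshifts `(X_σ, T)`,
`(X_τ, T)`, `(X_{σ∘τ}, T)` and `(X_{τ∘σ}, T)` are pairwise topologically
conjugate. -/
theorem conjugate_subshifts_of_proper_primitive {A : Type*} [Fintype A]
    [TopologicalSpace A] [DiscreteTopology A]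
    (σ τ : A → List A) (hprim : Primitive σ)
    (hconj :
      (∃ (l : A) (u : A → List A),
        (∀ x : A, σ x = l :: u x) ∧ (∀ x : A, τ x = u x ++ [l])) ∨
      (∃ (r : A) (u : A → List A),
        (∀ x : A, σ x = u x ++ [r]) ∧ (∀ x : A, τ x = r :: u x))) :
    ShiftConjugate (Xgen σ) (Xgen τ) ∧
    ShiftConjugate (Xgen σ) (Xgen (compMor σ τ)) ∧
    ShiftConjugate (Xgen σ) (Xgen (compMor τ σ)) ∧
    ShiftConjugate (Xgen τ) (Xgen (compMor σ τ)) ∧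
    ShiftConjugate (Xgen τ) (Xgen (compMor τ σ)) ∧
    ShiftConjugate (Xgen (compMor σ τ)) (Xgen (compMor τ σ)) := by
  have key : Xgen σ = Xgen τ ∧ Xgen σ = Xgen (compMor σ τ) ∧ Xgen σ = Xgen (compMor τ σ) := by
    rcases hconj with ⟨l, u, hσ, hτ⟩ | ⟨r, u, hσ, hτ⟩
    · exact Xgen_eq_Xgen_compMor (p := [l]) (fun a => by simp [hσ, hτ])
        (fun a => by simp [hσ]) hprim
    · have hcomm : ∀ a, τ a ++ [r] = [r] ++ σ a := fun a => by simp [hσ, hτ]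
      have hpτ := (primitive_iff_of_append_comm hcomm).2 hprim
      obtain ⟨h₁, h₂, h₃⟩ := Xgen_eq_Xgen_compMor hcomm (fun a => by simp [hτ]) hpτ
      exact ⟨h₁.symm, h₁.symm.trans h₃, h₁.symm.trans h₂⟩
  obtain ⟨h₁, h₂, h₃⟩ := key
  exact ⟨.of_eq h₁, .of_eq h₂, .of_eq h₃, .of_eq (h₁.symm.trans h₂), .of_eq (h₁.symm.trans h₃),
    .of_eq (h₂.symm.trans h₃)⟩
end

section
/- Let A be a finite alphabet and x ∈ A^ℕ an infinite sequence with word complexity p_x(n) = n + 1 for all n ≥ 1. Then x is uniformly recurrent: for every factor w of x there exists K ≥ 1 such that every factor of x of length K contains an occurrence of w. -/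
/-- The factor `x_i x_{i+1} ⋯ x_{i+n-1}` of the infinite sequence `x`. -/
def segN {A : Type*} (x : ℕ → A) (i n : ℕ) : List A :=
  (List.range n).map fun k => x (i + k)

/-- The set of factors of length `n` of the infinite sequence `x`. -/
def factors {A : Type*} (x : ℕ → A) (n : ℕ) : Set (List A) :=
  { w | ∃ i : ℕ, segN x i n = w }

/-- The word complexity of `x`: the number of distinct factors of length `n`. -/
noncomputable def complexityN {A : Type*} (x : ℕ → A) (n : ℕ) : ℕ :=
  (factors x n).ncard

/-- `x` is eventually periodic, with a period `j - i` valid from index `i` on. -/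
def EventuallyPeriodicSeq {A : Type*} (x : ℕ → A) : Prop :=
  ∃ i j : ℕ, i < j ∧ ∀ t, x (i + t) = x (j + t)

/-- The length-`n` factor of `x` at position `s` is right special: it also occurs at a position
where it is followed by a different letter. -/
def RightSpecialAt {A : Type*} (x : ℕ → A) (n s : ℕ) : Prop :=
  ∃ s' : ℕ, segN x s' n = segN x s n ∧ x (s' + n) ≠ x (s + n)

section

variable {A : Type*} (x : ℕ → A)

lemma length_segN (i n : ℕ) : (segN x i n).length = n := by simp [segN]

lemma segN_add (i a b : ℕ) : segN x i (a + b) = segN x i a ++ segN x (i + a) b := by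
  simp [segN, List.range_add, Function.comp_def, Nat.add_assoc]

lemma segN_succ (i n : ℕ) : segN x i (n + 1) = segN x i n ++ [x (i + n)] := by
  simp [segN, List.range_succ]

variable {x}

lemma segN_eq_segN_iff {i j n : ℕ} :
    segN x i n = segN x j n ↔ ∀ k < n, x (i + k) = x (j + k) := by
  simp [segN]

lemma segN_succ_eq_iff {i j n : ℕ} :
    segN x i (n + 1) = segN x j (n + 1) ↔
      segN x i n = segN x j n ∧ x (i + n) = x (j + n) := by
  simp only [segN_eq_segN_iff]
  exact Nat.forall_lt_succ_right

variable (x) in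
lemma finite_factors [Finite A] (n : ℕ) : (factors x n).Finite :=
  (List.finite_length_eq A n).subset fun w ⟨i, hi⟩ => by simp [← hi, length_segN]

/-- Repeating a factor determines the sequence when no factor in between is right special. -/
lemma eventuallyPeriodicSeq_of_not_rightSpecialAt {i j n : ℕ} (hij : i < j)
    (heq : segN x i n = segN x j n) (h : ∀ t, i ≤ t → t < j → ¬ RightSpecialAt x n t) :
    EventuallyPeriodicSeq x := by
  have key : ∀ t, segN x (i + t) n = segN x (j + t) n ∧ ¬ RightSpecialAt x n (i + t) := by
    intro t
    induction t using Nat.strong_induction_on with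
    | _ t ih =>
      constructor
      · cases t with
        | zero => simpa using heq
        | succ t =>
          obtain ⟨h1, h2⟩ := ih t (Nat.lt_succ_self t)
          have h3 : x (j + t + n) = x (i + t + n) := by
            by_contra hne
            exact h2 ⟨j + t, h1.symm, hne⟩
          have h4 := segN_succ_eq_iff.2 ⟨h1, h3.symm⟩
          rw [segN_eq_segN_iff] at h4 ⊢
          intro k hk
          have := h4 (k + 1) (by omega)
          convert this using 2 <;> omega
      · by_cases ht : t < j - i
        · exact h _ (by omega) (by omega)
        · obtain ⟨h1, h2⟩ := ih (t - (j - i)) (by omega)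
          rw [show j + (t - (j - i)) = i + t by omega] at h1
          rintro ⟨s, hs, hne⟩
          by_cases hc : x (i + t + n) = x (i + (t - (j - i)) + n)
          · exact h2 ⟨s, hs.trans h1.symm, fun e => hne (e.trans hc.symm)⟩
          · exact h2 ⟨i + t, h1.symm, hc⟩
  refine ⟨i + n, j + n, by omega, fun t => ?_⟩
  obtain ⟨h1, h2⟩ := key t
  by_contra hne
  refine h2 ⟨j + t, h1.symm, fun e => hne ?_⟩
  rw [show i + n + t = i + t + n by omega, show j + n + t = j + t + n by omega, e]

lemma complexityN_le_of_eventuallyPeriodicSeq (h : EventuallyPeriodicSeq x) :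
    ∃ C, ∀ n, complexityN x n ≤ C := by
  obtain ⟨i, j, hij, hx⟩ := h
  refine ⟨j, fun n => ?_⟩
  have hred : ∀ s, ∃ r < j, segN x r n = segN x s n := by
    intro s
    induction s using Nat.strong_induction_on with
    | _ s ih =>
      by_cases hs : s < j
      · exact ⟨s, hs, rfl⟩
      · obtain ⟨r, hr, hrs⟩ := ih (s - (j - i)) (by omega)
        refine ⟨r, hr, hrs.trans (segN_eq_segN_iff.2 fun k _ => ?_)⟩
        have := hx (s - j + k)
        convert this using 2 <;> omega
  have hsub : factors x n ⊆ (fun r => segN x r n) '' Set.Iio j := by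
    rintro w ⟨s, rfl⟩
    obtain ⟨r, hr, hrs⟩ := hred s
    exact ⟨r, hr, hrs⟩
  calc complexityN x n ≤ ((fun r => segN x r n) '' Set.Iio j).ncard :=
        Set.ncard_le_ncard hsub ((Set.finite_Iio j).image _)
    _ ≤ (Set.Iio j).ncard := Set.ncard_image_le (Set.finite_Iio j)
    _ = j := by simp [← Finset.coe_Iio, Set.ncard_coe_finset]

/-- Factors of length `n` still have an extension after removing, for each position in `S`, the
extension read there, provided the factors at these positions are distinct and right special. -/
lemma complexityN_add_card_le [Finite A] {n : ℕ} (S : Finset ℕ)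
    (hS : ∀ s ∈ S, RightSpecialAt x n s)
    (hinj : Set.InjOn (fun s => segN x s n) S) :
    complexityN x n + S.card ≤ complexityN x (n + 1) := by
  classical
  set E : Set (List A) := (fun s => segN x s (n + 1)) '' (S : Set ℕ) with hE
  have hEF : E ⊆ factors x (n + 1) := by
    rintro _ ⟨s, -, rfl⟩
    exact ⟨s, rfl⟩
  have hEcard : E.ncard = S.card := by
    have hinj' : Set.InjOn (fun s => segN x s (n + 1)) (S : Set ℕ) :=
      fun s hs t ht hst => hinj hs ht (segN_succ_eq_iff.1 hst).1
    rw [hE, hinj'.ncard_image, Set.ncard_coe_finset]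
  have hsub : factors x n ⊆ List.dropLast '' (factors x (n + 1) \ E) := by
    rintro _ ⟨r, rfl⟩
    by_cases hr : segN x r (n + 1) ∈ E
    · obtain ⟨s, hs, hsr⟩ := hr
      obtain ⟨s', hs', hne⟩ := hS s hs
      refine ⟨segN x s' (n + 1), ⟨⟨s', rfl⟩, ?_⟩, ?_⟩
      · rintro ⟨u, hu, hus⟩
        obtain ⟨h1, h2⟩ := segN_succ_eq_iff.1 hus
        obtain rfl := hinj hu hs (h1.trans hs')
        exact hne h2.symm
      · rw [segN_succ, List.dropLast_concat, hs', (segN_succ_eq_iff.1 hsr).1]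
    · exact ⟨segN x r (n + 1), ⟨⟨r, rfl⟩, hr⟩, by rw [segN_succ, List.dropLast_concat]⟩
  have hfin := finite_factors x (n + 1)
  have h1 : (factors x n).ncard ≤ (factors x (n + 1) \ E).ncard :=
    (Set.ncard_le_ncard hsub (hfin.sdiff.image _)).trans (Set.ncard_image_le hfin.sdiff)
  have h2 := Set.ncard_sdiff_add_ncard_of_subset hEF hfin
  unfold complexityN
  omega

lemma exists_segN_eq_of_complexityN_lt [Finite A] {n N : ℕ} (h : complexityN x n < N) (i : ℕ) :
    ∃ a b, i ≤ a ∧ a < b ∧ b < i + N ∧ segN x a n = segN x b n := by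
  classical
  have hfin := finite_factors x n
  obtain ⟨a, ha, b, hb, hab, heq⟩ := Finset.exists_ne_map_eq_of_card_lt_of_maps_to
    (s := Finset.Ico i (i + N)) (t := hfin.toFinset) (f := fun s => segN x s n)
    (by rw [← Set.ncard_eq_toFinset_card _ hfin]; simpa [complexityN] using h)
    (by intro s _; simpa using ⟨s, rfl⟩)
  rw [Finset.mem_Ico] at ha hb
  rcases lt_or_gt_of_ne hab with hlt | hlt
  · exact ⟨a, b, ha.1, hlt, hb.2, heq⟩
  · exact ⟨b, a, hb.1, hlt, ha.2, heq.symm⟩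

/-- The Morse–Hedlund theorem. -/
lemma lt_complexityN_of_not_eventuallyPeriodicSeq [Finite A] (h : ¬ EventuallyPeriodicSeq x)
    (n : ℕ) : n < complexityN x n := by
  induction n with
  | zero => exact (Set.ncard_pos (finite_factors x 0)).2 ⟨_, 0, rfl⟩
  | succ n ih =>
    obtain ⟨s, hs⟩ : ∃ s, RightSpecialAt x n s := by
      by_contra! hns
      obtain ⟨a, b, -, hab, -, heq⟩ :=
        exists_segN_eq_of_complexityN_lt (Nat.lt_succ_self (complexityN x n)) 0
      exact h (eventuallyPeriodicSeq_of_not_rightSpecialAt hab heq fun t _ _ => hns t)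
    have := complexityN_add_card_le {s} (by simpa using hs) (by simp)
    rw [Finset.card_singleton] at this
    omega

/-- The factors of length `n` of an aperiodic sequence of complexity at most `n + 1` occur
arbitrarily far. -/
lemma exists_segN_eq_of_complexityN_le [Finite A] (h : ¬ EventuallyPeriodicSeq x) {n : ℕ}
    (hn : complexityN x n ≤ n + 1) (i m : ℕ) : ∃ j, m ≤ j ∧ segN x j n = segN x i n := by
  set y : ℕ → A := fun k => x (m + k) with hy
  have hseg : ∀ k, segN y k n = segN x (m + k) n := fun k => by simp [segN, hy, Nat.add_assoc]
  have hyp : ¬ EventuallyPeriodicSeq y := by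
    rintro ⟨a, b, hab, hper⟩
    refine h ⟨m + a, m + b, by omega, fun t => ?_⟩
    simpa [hy, Nat.add_assoc] using hper t
  have hsub : factors y n ⊆ factors x n := by
    rintro _ ⟨k, rfl⟩
    exact ⟨m + k, (hseg k).symm⟩
  have heq := Set.eq_of_subset_of_ncard_le hsub
    (hn.trans (lt_complexityN_of_not_eventuallyPeriodicSeq hyp n)) (finite_factors x n)
  have hi : segN x i n ∈ factors y n := heq ▸ ⟨i, rfl⟩
  obtain ⟨k, hk⟩ := hi
  exact ⟨m + k, by omega, (hseg k).symm.trans hk⟩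

lemma segN_eq_of_rightSpecialAt [Finite A] {n s t : ℕ}
    (hn : complexityN x (n + 1) ≤ complexityN x n + 1)
    (hs : RightSpecialAt x n s) (ht : RightSpecialAt x n t) : segN x s n = segN x t n := by
  by_contra hne
  have hst : s ≠ t := fun e => hne (e ▸ rfl)
  have := complexityN_add_card_le (x := x) (n := n) {s, t} (by simp [hs, ht])
    (by simp [Set.injOn_pair, hne])
  rw [Finset.card_pair hst] at this
  omega

/-- The only right special factor of a given length occurs with bounded gaps. -/
lemma exists_segN_eq_of_rightSpecialAt [Finite A] (h : ¬ EventuallyPeriodicSeq x) {n s : ℕ}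
    (hn : complexityN x (n + 1) ≤ complexityN x n + 1) (hs : RightSpecialAt x n s) (i : ℕ) :
    ∃ t, i ≤ t ∧ t ≤ i + complexityN x n ∧ segN x t n = segN x s n := by
  obtain ⟨a, b, ha, hab, hb, heq⟩ :=
    exists_segN_eq_of_complexityN_lt (Nat.lt_succ_self (complexityN x n)) i
  by_contra! hno
  refine h (eventuallyPeriodicSeq_of_not_rightSpecialAt hab heq fun t hat htb ht => ?_)
  exact hno t (by omega) (by omega) (segN_eq_of_rightSpecialAt hn ht hs)

/-- In an aperiodic sequence, a factor that occurs twice is a prefix of a right special factor. -/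
lemma exists_rightSpecialAt_of_segN_eq (h : ¬ EventuallyPeriodicSeq x) {i j n : ℕ} (hij : i < j)
    (heq : segN x j n = segN x i n) : ∃ m, n ≤ m ∧ RightSpecialAt x m i := by
  classical
  have hex : ∃ t, x (j + t) ≠ x (i + t) := by
    by_contra! hall
    exact h ⟨i, j, hij, fun t => (hall t).symm⟩
  refine ⟨Nat.find hex, ?_, j, ?_, Nat.find_spec hex⟩
  · by_contra! hlt
    exact Nat.find_spec hex (segN_eq_segN_iff.1 heq _ hlt)
  · exact segN_eq_segN_iff.2 fun k hk => not_not.1 (Nat.find_min hex hk)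

end

/-- An infinite sequence `x` over a finite alphabet with complexity
`p_x(n) = n + 1` for all `n ≥ 1` is uniformly recurrent: for every factor `w` of
`x` there is `K ≥ 1` such that every factor of `x` of length `K` contains an
occurrence of `w`. -/
theorem uniformly_recurrent_of_complexity_succ {A : Type*} [Fintype A] (x : ℕ → A)
    (hcompl : ∀ n : ℕ, 1 ≤ n → complexityN x n = n + 1) :
    ∀ w : List A, (∃ i : ℕ, segN x i w.length = w) →
      ∃ K : ℕ, 1 ≤ K ∧ ∀ i : ℕ, w <:+: segN x i K := by
  have haper : ¬ EventuallyPeriodicSeq x := by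
    intro h
    obtain ⟨C, hC⟩ := complexityN_le_of_eventuallyPeriodicSeq h
    have h1 := hC (C + 1)
    rw [hcompl (C + 1) (by omega)] at h1
    omega
  have hzero : complexityN x 0 = 1 := by
    have : factors x 0 = {[]} := by
      ext w
      simp [factors, segN, eq_comm]
    rw [complexityN, this, Set.ncard_singleton]
  have hall : ∀ n, complexityN x n = n + 1 := by
    intro n
    cases n with
    | zero => exact hzero
    | succ n => exact hcompl _ (by omega)
  rintro w ⟨i, hi⟩
  obtain ⟨j, hij, hj⟩ := exists_segN_eq_of_complexityN_le haper (hall w.length).le i (i + 1)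
  obtain ⟨m, hm, hs⟩ := exists_rightSpecialAt_of_segN_eq haper hij hj
  refine ⟨m + 1 + w.length, by omega, fun k => ?_⟩
  obtain ⟨t, hkt, ht, hseg⟩ := exists_segN_eq_of_rightSpecialAt haper
    (by rw [hall, hall]) hs k
  rw [hall] at ht
  have hw : segN x t w.length = w := by
    rw [← hi, length_segN, segN_eq_segN_iff]
    exact fun l hl => segN_eq_segN_iff.1 hseg l (by omega)
  refine ⟨segN x k (t - k), segN x (t + w.length) (m + 1 - (t - k)), ?_⟩
  have hsplit := segN_add x k (t - k + w.length) (m + 1 - (t - k))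
  rw [segN_add x k (t - k) w.length, show k + (t - k) = t by omega,
    show k + (t - k + w.length) = t + w.length by omega, hw,
    show t - k + w.length + (m + 1 - (t - k)) = m + 1 + w.length by omega] at hsplit
  exact hsplit.symm
end
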